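/- If f : ℝ^p → ℝ is nonnegative, differentiable, and L-Lipschitz, then its Gaussian convolution g = f * u_γ with γ > 0 satisfies the smoothness bound ‖∇²g(x)‖_op ≤ (L/√γ)·√(2/π) for all x. -/

import Mathlib

open MeasureTheory Real

/-- Density of the isotropic Gaussian `N(0, γ I_p)` on `ℝ^p`. -/
noncomputable def gaussDensity (p : ℕ) (γ : ℝ) (y : EuclideanSpace ℝ (Fin p)) : ℝ :=
  ((2 * π * γ) ^ ((p : ℝ) / 2))⁻¹ * Real.exp (-‖y‖ ^ 2 / (2 * γ))


lemma abs_moment_real {b : ℝ} (hb : 0 < b) :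
    ∫ t : ℝ, |t| * Real.exp (-b * t ^ 2) = b⁻¹ := by
  have h1 := integral_comp_abs (f := fun t : ℝ => t * Real.exp (-b * t ^ 2))
  simp only [sq_abs] at h1
  rw [h1]
  have h2 := integral_rpow_mul_exp_neg_mul_rpow (p := 2) (q := 1) (b := b)
    (by norm_num) (by norm_num) hb
  norm_num at h2
  simp only [Real.rpow_neg_one] at h2
  norm_num
  rw [h2]; ring

lemma moment_unit (p : ℕ) {b : ℝ} (hb : 0 < b) (e : EuclideanSpace ℝ (Fin p)) (he : ‖e‖ = 1) :
    ∫ z, |inner ℝ e z| * Real.exp (-b * ‖z‖ ^ 2) = b⁻¹ * √(π / b) ^ (p - 1) := by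
  obtain _ | n := p
  · have : e = 0 := Subsingleton.elim _ _
    simp [this] at he
  obtain ⟨B, hB⟩ := Orthonormal.exists_orthonormalBasis_extension_of_card_eq (𝕜 := ℝ)
    (E := EuclideanSpace ℝ (Fin (n+1))) (ι := Fin (n+1)) (by simp)
    (v := fun _ => e) (s := {0}) (by
      constructor
      · intro i; simpa using he
      · intro i j hij; exact absurd (Subsingleton.elim i j) hij)
  have hB0 : B 0 = e := hB 0 rfl
  have h1 := B.repr.symm.measurePreserving.integral_comp
    B.repr.symm.toMeasurableEquiv.measurableEmbedding
    (fun z => |inner ℝ e z| * Real.exp (-b * ‖z‖ ^ 2))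
  rw [← h1]
  have h3 : ∀ w : EuclideanSpace ℝ (Fin (n+1)), inner ℝ e (B.repr.symm w) = w 0 := by
    intro w
    rw [← hB0, ← B.repr_apply_apply]; simp
  simp only [h3, LinearIsometryEquiv.norm_map]
  rw [← (PiLp.volume_preserving_toLp (Fin (n+1))).integral_comp
    (MeasurableEquiv.toLp 2 (Fin (n+1) → ℝ)).measurableEmbedding]
  have h4 : ∀ w : Fin (n+1) → ℝ, |(WithLp.toLp 2 w : EuclideanSpace ℝ (Fin (n+1))) 0| *
      Real.exp (-b * ‖(WithLp.toLp 2 w : EuclideanSpace ℝ (Fin (n+1)))‖ ^ 2)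
      = ∏ i, (if i = 0 then fun t : ℝ => |t| * Real.exp (-b * t ^ 2) else
        fun t : ℝ => Real.exp (-b * t ^ 2)) (w i) := by
    intro w
    rw [EuclideanSpace.norm_sq_eq, Fin.prod_univ_succ, Fin.sum_univ_succ]
    simp [Fin.succ_ne_zero, ← Real.exp_sum, mul_add, Real.exp_add, Finset.mul_sum, mul_assoc]
  simp only [h4]
  rw [integral_fintype_prod_volume_eq_prod (f := fun (i : Fin (n+1)) => if i = 0 then fun t : ℝ => |t| * Real.exp (-b * t ^ 2) else
        fun t : ℝ => Real.exp (-b * t ^ 2)), Fin.prod_univ_succ]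
  simp only [Fin.succ_ne_zero, if_true, if_false, abs_moment_real hb, integral_gaussian]
  simp

lemma gauss_const (p : ℕ) (hp : 1 ≤ p) {γ : ℝ} (hγ : 0 < γ) :
    γ⁻¹ * ((2 * π * γ) ^ ((p : ℝ) / 2))⁻¹ * (((2 * γ)⁻¹)⁻¹ * √(π / (2 * γ)⁻¹) ^ (p - 1))
      = √(2 / π) / √γ := by
  obtain ⟨n, rfl⟩ : ∃ n, p = n + 1 := ⟨p - 1, by omega⟩
  have h0 : 0 < 2 * π * γ := by positivity
  have h1 : (2 * π * γ) ^ (((n + 1 : ℕ) : ℝ) / 2) = √(2 * π * γ) ^ (n + 1) := by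
    rw [Real.sqrt_eq_rpow, ← Real.rpow_natCast, ← Real.rpow_mul h0.le]
    congr 1; ring
  have h2 : π / (2 * γ)⁻¹ = 2 * π * γ := by field_simp
  rw [h1, h2, inv_inv]
  have hs : 0 < √(2 * π * γ) := Real.sqrt_pos.2 h0
  have h3 : √(2 / π) / √γ = 2 / √(2 * π * γ) := by
    rw [← Real.sqrt_div (by positivity), div_div, eq_div_iff hs.ne', ← Real.sqrt_mul (by positivity)]
    rw [show 2 / (π * γ) * (2 * π * γ) = 2 ^ 2 by field_simp]
    simp
  rw [h3, Nat.add_sub_cancel, pow_succ]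
  field_simp

lemma gauss_eq (p : ℕ) (γ : ℝ) : gaussDensity p γ =
    fun y => ((2 * π * γ) ^ ((p : ℝ) / 2))⁻¹ * Real.exp (-(2 * γ)⁻¹ * ‖y‖ ^ 2) := by
  ext y
  rw [gaussDensity]; congr 2; ring

lemma gauss_cont (p : ℕ) (γ : ℝ) : Continuous (gaussDensity p γ) := by
  rw [gauss_eq]; fun_prop

lemma gauss_nonneg (p : ℕ) {γ : ℝ} (hγ : 0 < γ) (y) : 0 ≤ gaussDensity p γ y := by
  unfold gaussDensity; positivity

lemma gauss_int (p : ℕ) {γ : ℝ} (hγ : 0 < γ) : Integrable (gaussDensity p γ) := by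
  rw [gauss_eq]
  apply Integrable.const_mul
  apply Integrable.of_integral_ne_zero
  rw [GaussianFourier.integral_rexp_neg_mul_sq_norm (by positivity)]
  positivity

lemma moment_enorm (p : ℕ) {γ : ℝ} (hγ : 0 < γ) (v : EuclideanSpace ℝ (Fin p)) :
    ∫⁻ z, ‖γ⁻¹ * inner ℝ v z * gaussDensity p γ z‖ₑ
      = ENNReal.ofReal (‖v‖ * (√(2 / π) / √γ)) := by
  rcases eq_or_ne v 0 with rfl | hv
  · simp
  have hp : 1 ≤ p := by
    rcases Nat.eq_zero_or_pos p with rfl | h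
    · exact absurd (Subsingleton.elim v 0) hv
    · exact h
  have hv' : 0 < ‖v‖ := norm_pos_iff.2 hv
  have hm := moment_unit p (b := (2 * γ)⁻¹) (by positivity) (‖v‖⁻¹ • v)
    (by rw [norm_smul]; simp [hv'.ne'])
  have hi : Integrable (fun z => |inner ℝ (‖v‖⁻¹ • v) z| * Real.exp (-(2 * γ)⁻¹ * ‖z‖ ^ 2)) := by
    apply Integrable.of_integral_ne_zero
    rw [hm]; positivity
  have key : ∀ z, ‖γ⁻¹ * inner ℝ v z * gaussDensity p γ z‖ₑ = ENNReal.ofReal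
      ((‖v‖ * (γ⁻¹ * ((2 * π * γ) ^ ((p : ℝ) / 2))⁻¹)) *
        (|inner ℝ (‖v‖⁻¹ • v) z| * Real.exp (-(2 * γ)⁻¹ * ‖z‖ ^ 2))) := by
    intro z
    rw [← ofReal_norm, Real.norm_eq_abs, abs_mul, abs_mul,
      abs_of_nonneg (gauss_nonneg p hγ z), gauss_eq, real_inner_smul_left, abs_mul,
      abs_of_pos (inv_pos.2 hγ), abs_of_pos (inv_pos.2 hv')]
    congr 1
    field_simp
  simp only [key]
  rw [← ofReal_integral_eq_lintegral_ofReal (hi.const_mul _)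
    (Filter.Eventually.of_forall fun z => by positivity), integral_const_mul, hm, mul_assoc,
    gauss_const p hp hγ]

lemma gauss_deriv (p : ℕ) {γ : ℝ} (hγ : 0 < γ) (a v : EuclideanSpace ℝ (Fin p)) (t : ℝ) :
    HasDerivAt (fun t : ℝ => gaussDensity p γ (a + t • v))
      (-(γ⁻¹ * inner ℝ v (a + t • v) * gaussDensity p γ (a + t • v))) t := by
  rw [gauss_eq]
  have h1 : HasDerivAt (fun t : ℝ => a + t • v) v t := by
    simpa using ((hasDerivAt_id t).smul_const v).const_add a
  have h2 := ((h1.norm_sq.const_mul (-(2 * γ)⁻¹)).exp).const_mul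
    (((2 * π * γ) ^ ((p : ℝ) / 2))⁻¹)
  refine h2.congr_deriv ?_
  rw [real_inner_comm]
  field_simp

lemma gauss_tv (p : ℕ) {γ : ℝ} (hγ : 0 < γ) (x x' : EuclideanSpace ℝ (Fin p)) :
    ∫⁻ z, ‖gaussDensity p γ (x - z) - gaussDensity p γ (x' - z)‖ₑ
      ≤ ENNReal.ofReal (‖x - x'‖ * (√(2 / π) / √γ)) := by
  set v := x - x' with hv
  have hc := gauss_cont p γ
  have h1 : ∀ z, ‖gaussDensity p γ (x - z) - gaussDensity p γ (x' - z)‖ₑ ≤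
      ∫⁻ t in Set.Ioc (0:ℝ) 1, ‖γ⁻¹ * inner ℝ v ((x' - z) + t • v) *
        gaussDensity p γ ((x' - z) + t • v)‖ₑ := by
    intro z
    have := intervalIntegral.integral_eq_sub_of_hasDerivAt (a := 0) (b := 1)
      (fun t _ => gauss_deriv p hγ (x' - z) v t)
      (Continuous.intervalIntegrable (by fun_prop) _ _)
    have e1 : x' - z + (1:ℝ) • v = x - z := by rw [hv]; module
    rw [e1, zero_smul, add_zero] at this
    rw [← this, intervalIntegral.integral_of_le zero_le_one]
    refine (enorm_integral_le_lintegral_enorm _).trans ?_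
    simp
  refine (lintegral_mono h1).trans ?_
  rw [lintegral_lintegral_swap (by
    apply Continuous.aemeasurable
    unfold Function.uncurry
    fun_prop)]
  have h2 : ∀ t : ℝ, ∫⁻ z, ‖γ⁻¹ * inner ℝ v ((x' - z) + t • v) *
        gaussDensity p γ ((x' - z) + t • v)‖ₑ = ENNReal.ofReal (‖v‖ * (√(2 / π) / √γ)) := by
    intro t
    rw [← moment_enorm p hγ v, ← lintegral_sub_left_eq_self _ (x' + t • v)]
    congr 1; ext z
    rw [show x' - (x' + t • v - z) + t • v = z by abel]
  simp only [h2]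
  simp

theorem hessian_bound_of_gaussian_convolution (p : ℕ) (γ : ℝ) (hγ : 0 < γ)
    (f : EuclideanSpace ℝ (Fin p) → ℝ) (L : ℝ) (hL : 0 ≤ L)
    (hf_nonneg : ∀ x, 0 ≤ f x) (hf_diff : Differentiable ℝ f)
    (hf_grad : ∀ x, ‖fderiv ℝ f x‖ ≤ L) :
    ∀ x, ‖fderiv ℝ (fderiv ℝ (fun x' => ∫ y, f (x' - y) * gaussDensity p γ y)) x‖ ≤
      L / Real.sqrt γ * Real.sqrt (2 / π) := by
  intro x
  have hu := gauss_int p hγ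
  have hc := gauss_cont p γ
  have hfc := hf_diff.continuous
  by_cases hint : ∃ x₀, Integrable (fun y => f (x₀ - y) * gaussDensity p γ y)
  swap
  · push Not at hint
    have : (fun x' => ∫ y, f (x' - y) * gaussDensity p γ y) = fun _ => 0 := by
      ext x'; exact integral_undef (hint x')
    rw [this]
    have h0 : 0 ≤ L / √γ * √(2 / π) := by positivity
    have h6 : fderiv ℝ (fun _ : EuclideanSpace ℝ (Fin p) => (0 : ℝ)) = fun _ => 0 := by
      ext1 z; exact (hasFDerivAt_const (0 : ℝ) z).fderiv
    rw [h6, (hasFDerivAt_const (0 : EuclideanSpace ℝ (Fin p) →L[ℝ] ℝ) x).fderiv]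
    exact (norm_zero (E := EuclideanSpace ℝ (Fin p) →L[ℝ] EuclideanSpace ℝ (Fin p) →L[ℝ] ℝ)).trans_le h0
  obtain ⟨x₀, hx₀⟩ := hint
  have hlip : ∀ a b, ‖f a - f b‖ ≤ L * ‖a - b‖ := fun a b =>
    convex_univ.norm_image_sub_le_of_norm_fderiv_le (fun y _ => hf_diff y)
      (fun y _ => hf_grad y) (Set.mem_univ b) (Set.mem_univ a)
  have hint : ∀ x, Integrable (fun y => f (x - y) * gaussDensity p γ y) := by
    intro x
    have h : Integrable (fun y => (f (x - y) - f (x₀ - y)) * gaussDensity p γ y) := by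
      refine (hu.const_mul (L * ‖x - x₀‖)).mono' (by fun_prop) ?_
      refine Filter.Eventually.of_forall fun y => ?_
      rw [norm_mul, Real.norm_of_nonneg (gauss_nonneg p hγ y)]
      refine mul_le_mul_of_nonneg_right ?_ (gauss_nonneg p hγ y)
      simpa using hlip (x - y) (x₀ - y)
    refine (h.add hx₀).congr (Filter.Eventually.of_forall fun y => ?_)
    simp only [Pi.add_apply]; ring
  have hm : Measurable (fderiv ℝ f) := measurable_fderiv ℝ f
  have hsm : StronglyMeasurable (fderiv ℝ f) := hm.stronglyMeasurable
  have hgrad : fderiv ℝ (fun x' => ∫ y, f (x' - y) * gaussDensity p γ y) =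
      fun x => ∫ y, gaussDensity p γ (x - y) • fderiv ℝ f y := by
    ext1 x
    have h := hasFDerivAt_integral_of_dominated_of_fderiv_le (𝕜 := ℝ) (μ := volume)
      (F := fun x y => f (x - y) * gaussDensity p γ y)
      (F' := fun x y => gaussDensity p γ y • fderiv ℝ f (x - y)) (x₀ := x) (s := Set.univ)
      (bound := fun y => gaussDensity p γ y * L) Filter.univ_mem
      (Filter.Eventually.of_forall fun x => (hint x).aestronglyMeasurable) (hint x)
      (hc.aestronglyMeasurable.smul
        (hsm.comp_measurable (by fun_prop)).aestronglyMeasurable)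
      (Filter.Eventually.of_forall fun y x _ => by
        rw [norm_smul, Real.norm_of_nonneg (gauss_nonneg p hγ y)]
        exact mul_le_mul_of_nonneg_left (hf_grad _) (gauss_nonneg p hγ y))
      (hu.mul_const L)
      (Filter.Eventually.of_forall fun y x _ => by
        refine HasFDerivAt.mul_const ?_ _
        have h5 := (hf_diff (x - y)).hasFDerivAt.comp x ((hasFDerivAt_id x).sub_const y)
        exact h5)
    rw [h.fderiv, ← integral_sub_left_eq_self _ volume x]
    simp
  rw [hgrad]
  have hC : 0 ≤ L / √γ * √(2 / π) := by positivity
  have hI : ∀ x, Integrable (fun y => gaussDensity p γ (x - y) • fderiv ℝ f y) := by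
    intro x
    refine ((hu.comp_sub_left x).mul_const L).mono'
      ((by fun_prop : Continuous fun y => gaussDensity p γ (x - y)).aestronglyMeasurable.smul
        hsm.aestronglyMeasurable) (Filter.Eventually.of_forall fun y => ?_)
    rw [norm_smul, Real.norm_of_nonneg (gauss_nonneg p hγ _)]
    exact mul_le_mul_of_nonneg_left (hf_grad _) (gauss_nonneg p hγ _)
  have hLip : LipschitzWith ⟨_, hC⟩ (fun x => ∫ y, gaussDensity p γ (x - y) • fderiv ℝ f y) := by
    refine LipschitzWith.of_dist_le_mul fun a b => ?_
    rw [dist_eq_norm, dist_eq_norm, ← integral_sub (hI a) (hI b)]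
    have h : ‖∫ y, (gaussDensity p γ (a - y) • fderiv ℝ f y -
        gaussDensity p γ (b - y) • fderiv ℝ f y)‖ₑ ≤
        ENNReal.ofReal (‖a - b‖ * (√(2 / π) / √γ) * L) := by
      refine (enorm_integral_le_lintegral_enorm _).trans ?_
      rw [ENNReal.ofReal_mul (by positivity)]
      refine le_trans ?_ (mul_le_mul_left (gauss_tv p hγ a b) _)
      rw [← lintegral_mul_const' _ _ ENNReal.ofReal_ne_top]
      refine lintegral_mono fun y => ?_
      rw [← sub_smul, enorm_smul]
      refine mul_le_mul_right ?_ _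
      rw [← ofReal_norm]
      exact ENNReal.ofReal_le_ofReal (hf_grad y)
    rw [← ofReal_norm, ENNReal.ofReal_le_ofReal_iff (by positivity)] at h
    refine h.trans (le_of_eq ?_)
    show _ = L / √γ * √(2 / π) * ‖a - b‖
    ring
  exact norm_fderiv_le_of_lipschitz ℝ hLip
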